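/- Let X be a simply connected pointed space and Γ a finite open cover of I^n with n > 1. Then there exist a finite open cover Δ of I^{n-1}, a function λ: Δ → Γ(n−1) (assigning to each F ∈ Δ a union of at most n−1 elements of Γ), and a function Φ: Π_n(X) → Π_n(X) such that: (1) Φ(a) is homotopic to a rel ∂I^n for all a ∈ Π_n(X), and (2) for all F ∈ Δ and a, a′ ∈ Π_n(X), if a|_{λ(F)} = a′|_{λ(F)} then Φ(a)|_{F×I} = Φ(a′)|_{F×I}. -/

import Mathlib

open scoped unitInterval Topology
open ContinuousMap
open scoped Classical

noncomputable section

abbrev Cube (n : ℕ) := Fin n → I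

/-- Restriction of a continuous map to a subset of the cube. -/
def restrictMap {n : ℕ} {X : Type*} [TopologicalSpace X] (a : C(Cube n, X))
    (E : Set (Cube n)) : C(E, X) :=
  a.comp ⟨Subtype.val, continuous_subtype_val⟩

/-- `Π(E, X)`: maps `E → X` sending `E ∩ ∂Iⁿ` to the basepoint. -/
def PartMap {n : ℕ} (E : Set (Cube n)) (X : Type*) [TopologicalSpace X] (x0 : X) : Type _ :=
  {a : C(E, X) // ∀ y : E, (y : Cube n) ∈ Cube.boundary (Fin n) → a y = x0}

/-- Restriction of a spheroid to `E`, as an element of `Π(E, X)`. -/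
def sphRestrict {n : ℕ} {X : Type*} [TopologicalSpace X] {x0 : X}
    (a : GenLoop (Fin n) X x0) (E : Set (Cube n)) : PartMap E X x0 :=
  ⟨restrictMap a.1 E, fun y hy => a.2 y hy⟩

/-- The set `Γ(r)` of unions of at most `r` elements of `Γ`, as a `Finset`. -/
def coverUnions {n : ℕ} (Γ : Finset (Set (Cube n))) (r : ℕ) : Finset (Set (Cube n)) :=
  (Γ.powerset.filter fun S => S.card ≤ r).image fun S => ⋃₀ (S : Set (Set (Cube n)))

/-- `deg f ≤ r`: for every finite open cover `Γ` of `Iⁿ` there are functionals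
`g E : Π(E, X) → L`, `E ∈ Γ(r)`, with `f a = ∑_{E ∈ Γ(r)} g E (a|_E)`. -/
def HasDegLE {n : ℕ} {X : Type*} [TopologicalSpace X] {x0 : X} {L : Type*} [AddCommGroup L]
    (f : GenLoop (Fin n) X x0 → L) (r : ℕ) : Prop :=
  ∀ Γ : Finset (Set (Cube n)), (∀ E ∈ Γ, IsOpen E) → (∀ u : Cube n, ∃ E ∈ Γ, u ∈ E) →
    ∃ g : (E : Set (Cube n)) → (PartMap E X x0 → L),
      ∀ a : GenLoop (Fin n) X x0, f a = ∑ E ∈ coverUnions Γ r, g E (sphRestrict a E)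



abbrev pI (u : ℝ) : I := Set.projIcc (0:ℝ) 1 zero_le_one u

lemma pI_coe (u : ℝ) : ((pI u : I) : ℝ) = max 0 (min 1 u) := rfl

lemma pI_cont : Continuous pI := continuous_projIcc

lemma pI_of_mem {u : ℝ} (h0 : 0 ≤ u) (h1 : u ≤ 1) : ((pI u : I) : ℝ) = u := by
  rw [pI_coe, min_eq_right h1, max_eq_right h0]

lemma pI_zero {u : ℝ} (h : u ≤ 0) : pI u = 0 := Set.projIcc_of_le_left _ h
lemma pI_one {u : ℝ} (h : 1 ≤ u) : pI u = 1 := Set.projIcc_of_right_le _ h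

lemma pI_lip (u w : ℝ) : |((pI u : I) : ℝ) - pI w| ≤ |u - w| := by
  rw [pI_coe, pI_coe]
  rcases le_total u 0 with h1 | h1 <;> rcases le_total w 0 with h2 | h2 <;>
  rcases le_total u 1 with h3 | h3 <;> rcases le_total w 1 with h4 | h4 <;>
  simp only [h1, h2, h3, h4, min_eq_left, min_eq_right, max_eq_left, max_eq_right,
    zero_le_one, sub_self, abs_zero, abs_nonneg] <;>
  first
  | exact le_rfl
  | (rw [abs_le]; constructor <;> cases abs_cases (u - w) <;> linarith)

lemma pI_ne_zero {u : ℝ} (h : pI u ≠ 0) : 0 < u := by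
  by_contra hh
  exact h (pI_zero (not_lt.mp hh))

section homot
variable {n : ℕ} {X : Type*} [TopologicalSpace X] {x0 : X}

def FacePres (h : C(Cube n, Cube n)) : Prop :=
  ∀ x i, (x i = 0 → h x i = 0) ∧ (x i = 1 → h x i = 1)

lemma FacePres.bdry {h : C(Cube n, Cube n)} (hh : FacePres h) {x : Cube n}
    (hx : x ∈ Cube.boundary (Fin n)) : h x ∈ Cube.boundary (Fin n) := by
  obtain ⟨i, hi⟩ := hx
  exact ⟨i, hi.imp (hh x i).1 (hh x i).2⟩

def compLoop (a : GenLoop (Fin n) X x0) (h : C(Cube n, Cube n)) (hh : FacePres h) :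
    GenLoop (Fin n) X x0 :=
  ⟨a.1.comp h, fun _ hx => a.2 _ (hh.bdry hx)⟩

lemma compLoop_homotopic (a : GenLoop (Fin n) X x0) (h : C(Cube n, Cube n)) (hh : FacePres h) :
    GenLoop.Homotopic (compLoop a h hh) a := by
  let K : C(I × Cube n, Cube n) :=
    ⟨fun q i => pI ((1 - (q.1 : ℝ)) * (h q.2 i : ℝ) + q.1 * (q.2 i : ℝ)), by
      refine continuous_pi fun i => pI_cont.comp ?_
      have h1 : Continuous fun q : I × Cube n => ((h q.2 i : I) : ℝ) :=
        continuous_subtype_val.comp ((continuous_apply i).comp (h.continuous.comp continuous_snd))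
      have h2 : Continuous fun q : I × Cube n => ((q.2 i : I) : ℝ) :=
        continuous_subtype_val.comp ((continuous_apply i).comp continuous_snd)
      have h3 : Continuous fun q : I × Cube n => ((q.1 : I) : ℝ) :=
        continuous_subtype_val.comp continuous_fst
      exact ((continuous_const.sub h3).mul h1).add (h3.mul h2)⟩
  refine ⟨⟨⟨a.1.comp K, ?_, ?_⟩, ?_⟩⟩
  · intro x
    change a.1 (K (0, x)) = a.1 (h x)
    congr 1
    funext i
    simp [K, pI]
  · intro x
    change a.1 (K (1, x)) = a.1 x
    congr 1
    funext i
    simp [K, pI]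
  · intro t x hx
    change a.1 (K (t, x)) = a.1 (h x)
    rw [show a.1 (h x) = x0 from a.2 _ (hh.bdry hx)]
    refine a.2 _ ?_
    obtain ⟨i, hi⟩ := hx
    refine ⟨i, hi.imp (fun h0 => ?_) (fun h1 => ?_)⟩
    · simp [K, pI, h0, (hh x i).1 h0]
    · simp [K, pI, h1, (hh x i).2 h1]

lemma cubeModify {Y K : Type*} [TopologicalSpace Y] [Finite K] (f : C(Y, X)) (φ : K → C(Y, I))
    (G : K → C(Y × I, X))
    (disj : ∀ k l x, φ k x ≠ 0 → φ l x ≠ 0 → k = l)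
    (h0 : ∀ k, ∀ x ∈ closure {x | φ k x ≠ 0}, G k (x, 0) = f x) :
    ∃ H : C(I × Y, X), (∀ k x t, φ k x ≠ 0 → H (t, x) = G k (x, t * φ k x)) ∧
      (∀ x t, (∀ k, φ k x = 0) → H (t, x) = f x) := by
  let F : I × Y → X := fun q =>
    if h : ∃ k, φ k q.2 ≠ 0 then G h.choose (q.2, q.1 * φ h.choose q.2) else f q.2
  have F1 : ∀ k x t, φ k x ≠ 0 → F (t, x) = G k (x, t * φ k x) := by
    intro k x t hk
    have h : ∃ k, φ k x ≠ 0 := ⟨k, hk⟩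
    have e : h.choose = k := disj _ _ x h.choose_spec hk
    simp only [F]
    rw [dif_pos h, e]
  have F2 : ∀ x t, (∀ k, φ k x = 0) → F (t, x) = f x := by
    intro x t hk
    have h : ¬ ∃ k, φ k x ≠ 0 := by push Not; exact hk
    simp only [F]
    rw [dif_neg h]
  have hopen : ∀ k, IsOpen {x | φ k x ≠ 0} := fun k =>
    isOpen_ne_fun (φ k).continuous continuous_const
  have Fc : Continuous F := by
    let S : Option K → Set (I × Y) := fun o => match o with
      | none => Prod.snd ⁻¹' {x | ∀ k, φ k x = 0}
      | some k => Prod.snd ⁻¹' closure {x | φ k x ≠ 0}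
    refine (locallyFinite_of_finite S).continuous ?_ ?_ ?_
    · rw [Set.eq_univ_iff_forall]
      rintro ⟨t, x⟩
      rw [Set.mem_iUnion]
      by_cases h : ∃ k, φ k x ≠ 0
      · obtain ⟨k, hk⟩ := h
        exact ⟨some k, subset_closure (show x ∈ {x | φ k x ≠ 0} from hk)⟩
      · push Not at h
        exact ⟨none, h⟩
    · rintro (_ | k)
      · refine IsClosed.preimage continuous_snd ?_
        rw [Set.ofPred_forall]
        exact isClosed_iInter fun k => isClosed_eq (φ k).continuous continuous_const
      · exact isClosed_closure.preimage continuous_snd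
    · rintro (_ | k)
      · refine ContinuousOn.congr (f := fun q => f q.2) (by fun_prop) ?_
        rintro ⟨t, x⟩ hx
        exact F2 x t hx
      · refine ContinuousOn.congr (f := fun q => G k (q.2, q.1 * φ k q.2)) (by fun_prop) ?_
        rintro ⟨t, x⟩ hx
        have hx' : x ∈ closure {x | φ k x ≠ 0} := hx
        by_cases h : ∃ l, φ l x ≠ 0
        · obtain ⟨l, hl⟩ := h
          obtain ⟨y, hy1, hy2⟩ := mem_closure_iff.mp hx' _ (hopen l) hl
          have : k = l := disj _ _ y hy2 hy1
          subst this
          exact F1 _ x t hl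
        · push Not at h
          change F (t, x) = G k (x, t * φ k x)
          rw [F2 x t h, h k, mul_zero, h0 k x hx']
  exact ⟨⟨F, Fc⟩, F1, F2⟩

lemma modLoop {K : Type*} [Finite K] (a : GenLoop (Fin n) X x0) (φ : K → C(Cube n, I))
    (G : K → C(Cube n × I, X))
    (disj : ∀ k l x, φ k x ≠ 0 → φ l x ≠ 0 → k = l)
    (h0 : ∀ k, ∀ x ∈ closure {x | φ k x ≠ 0}, G k (x, 0) = a.1 x)
    (hb : ∀ k x t, x ∈ Cube.boundary (Fin n) → φ k x ≠ 0 → G k (x, t) = x0) :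
    ∃ b : GenLoop (Fin n) X x0, GenLoop.Homotopic b a ∧
      (∀ k x, φ k x ≠ 0 → b.1 x = G k (x, φ k x)) ∧
      (∀ x, (∀ k, φ k x = 0) → b.1 x = a.1 x) := by
  obtain ⟨H, H1, H2⟩ := cubeModify a.1 φ G disj h0
  have Hb : ∀ t x, x ∈ Cube.boundary (Fin n) → H (t, x) = x0 := by
    intro t x hx
    by_cases h : ∃ l, φ l x ≠ 0
    · obtain ⟨l, hl⟩ := h
      rw [H1 l x t hl, hb l x _ hx hl]
    · push Not at h
      rw [H2 x t h]
      exact a.2 x hx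
  let b : GenLoop (Fin n) X x0 :=
    ⟨H.comp ⟨fun x => (1, x), by fun_prop⟩, fun x hx => Hb 1 x hx⟩
  refine ⟨b, ?_, ?_, ?_⟩
  · apply GenLoop.Homotopic.symm
    refine ⟨⟨⟨H, ?_, ?_⟩, ?_⟩⟩
    · intro x
      change H (0, x) = a.1 x
      by_cases h : ∃ l, φ l x ≠ 0
      · obtain ⟨l, hl⟩ := h
        rw [H1 l x 0 hl, zero_mul]
        exact h0 l x (subset_closure hl)
      · push Not at h
        exact H2 x 0 h
    · intro x
      rfl
    · intro t x hx
      change H (t, x) = a.1 x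
      rw [Hb t x hx]
      exact (a.2 x hx).symm
  · intro k x hk
    change H (1, x) = _
    rw [H1 k x 1 hk, one_mul]
  · intro x hk
    exact H2 x 1 hk

end homot

section collapse

/-- the ramp -/
def rampf (q δ x : ℝ) : ℝ := ((pI ((x - q) / (2 * δ) + 1 / 2) : I) : ℝ)

lemma rampf_zero {q δ x : ℝ} (hδ : 0 < δ) (h : x ≤ q - δ) : rampf q δ x = 0 := by
  unfold rampf
  rw [pI_zero]; · rfl
  have : (x - q) / (2 * δ) ≤ -(1 / 2) := by
    rw [div_le_iff₀ (by positivity)]; linarith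
  linarith

lemma rampf_one {q δ x : ℝ} (hδ : 0 < δ) (h : q + δ ≤ x) : rampf q δ x = 1 := by
  unfold rampf
  rw [pI_one]; · rfl
  have : (1 / 2) ≤ (x - q) / (2 * δ) := by
    rw [le_div_iff₀ (by positivity)]; linarith
  linarith

lemma rampf_nonneg (q δ x : ℝ) : 0 ≤ rampf q δ x := (pI _).2.1
lemma rampf_le (q δ x : ℝ) : rampf q δ x ≤ 1 := (pI _).2.2

lemma rampf_cont (q δ : ℝ) : Continuous (rampf q δ) := by
  unfold rampf
  refine continuous_subtype_val.comp (pI_cont.comp ?_)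
  exact ((continuous_id.sub continuous_const).div_const _).add continuous_const

def cfun (N : ℕ) (q : ℕ → ℝ) (δ x : ℝ) : ℝ := (∑ k ∈ Finset.range N, rampf (q k) δ x) / N

lemma cfun_cont (N : ℕ) (q : ℕ → ℝ) (δ : ℝ) : Continuous (cfun N q δ) := by
  unfold cfun
  exact (continuous_finsetSum _ fun k _ => rampf_cont (q k) δ).div_const _

lemma cfun_nonneg (N : ℕ) (q : ℕ → ℝ) (δ x : ℝ) : 0 ≤ cfun N q δ x :=
  div_nonneg (Finset.sum_nonneg fun _ _ => rampf_nonneg _ _ _) (Nat.cast_nonneg _)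

lemma cfun_le (N : ℕ) (q : ℕ → ℝ) (δ x : ℝ) : cfun N q δ x ≤ 1 := by
  unfold cfun
  refine div_le_one_of_le₀ ?_ (Nat.cast_nonneg _)
  calc _ ≤ ∑ k ∈ Finset.range N, (1 : ℝ) := Finset.sum_le_sum fun _ _ => rampf_le _ _ _
    _ = N := by simp

lemma cfun_nat {N : ℕ} {q : ℕ → ℝ} {δ x : ℝ} (hδ : 0 < δ)
    (h : ∀ k < N, x ≤ q k - δ ∨ q k + δ ≤ x) : ∃ j : ℕ, j ≤ N ∧ cfun N q δ x = j / N := by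
  suffices H : ∃ j : ℕ, j ≤ N ∧ ∑ k ∈ Finset.range N, rampf (q k) δ x = j by
    obtain ⟨j, hj, h2⟩ := H
    exact ⟨j, hj, by unfold cfun; rw [h2]⟩
  induction N with
  | zero => exact ⟨0, le_rfl, by simp⟩
  | succ N ih =>
    obtain ⟨j, hj, h2⟩ := ih fun k hk => h k (by omega)
    rw [Finset.sum_range_succ, h2]
    rcases h N (by omega) with h3 | h3
    · exact ⟨j, by omega, by rw [rampf_zero hδ h3, add_zero]⟩
    · exact ⟨j + 1, by omega, by rw [rampf_one hδ h3]; push_cast; ring⟩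

lemma sum_step (f : ℕ → ℝ) (v N : ℕ) (hv : v ≤ N) (h1 : ∀ k < v, f k = 1)
    (h0 : ∀ k, v ≤ k → k < N → f k = 0) : ∑ k ∈ Finset.range N, f k = v := by
  induction N, hv using Nat.le_induction with
  | base =>
    rw [Finset.sum_congr rfl (g := fun _ => (1 : ℝ)) fun k hk => h1 k (Finset.mem_range.mp hk)]
    simp
  | succ N hN ih =>
    rw [Finset.sum_range_succ, ih (fun k a b => h0 k a (by omega)), h0 N hN (by omega), add_zero]

lemma sum_step' (f : ℕ → ℝ) (v N : ℕ) (hv : v < N) (h1 : ∀ k < v, f k = 1)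
    (h0 : ∀ k, v < k → k < N → f k = 0) : ∑ k ∈ Finset.range N, f k = v + f v := by
  induction N, hv using Nat.le_induction with
  | base =>
    rw [Finset.sum_range_succ,
      Finset.sum_congr rfl (g := fun _ => (1 : ℝ)) fun k hk => h1 k (Finset.mem_range.mp hk)]
    simp
  | succ N hN ih =>
    rw [Finset.sum_range_succ, ih (fun k a b => h0 k a (by omega)), h0 N hN (by omega), add_zero]

lemma sum_close (f : ℕ → ℝ) (N : ℕ) (y : ℝ) (hy0 : 0 ≤ y) (hy : y ≤ N)
    (hf : ∀ k, 0 ≤ f k ∧ f k ≤ 1)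
    (h1 : ∀ k < N, (k : ℝ) + 1 ≤ y → f k = 1) (h0 : ∀ k < N, y ≤ k → f k = 0) :
    |∑ k ∈ Finset.range N, f k - y| ≤ 1 := by
  induction N with
  | zero => simp at hy; simp [le_antisymm hy hy0]
  | succ N ih =>
    rcases le_total y N with h | h
    · rw [Finset.sum_range_succ, h0 N (by omega) h, add_zero]
      exact ih h (fun k hk => h1 k (by omega)) (fun k hk => h0 k (by omega))
    · rw [sum_step' f N (N + 1) (by omega) (fun k hk => h1 k (by omega) ?_)
        (fun k hk hk' => by omega)]
      · push_cast at hy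
        rw [abs_le]; constructor <;> linarith [(hf N).1, (hf N).2]
      · have : (k : ℝ) + 1 ≤ N := by exact_mod_cast hk
        linarith

structure GoodQ (N : ℕ) (q : ℕ → ℝ) (δ : ℝ) : Prop where
  hN : 0 < N
  hδ : 0 < δ
  lo : ∀ k < N, (k : ℝ) / N ≤ q k - δ
  hi : ∀ k < N, q k + δ ≤ ((k : ℝ) + 1) / N

lemma cfun_close {N : ℕ} {q : ℕ → ℝ} {δ x : ℝ} (g : GoodQ N q δ) (h0 : 0 ≤ x) (h1 : x ≤ 1) :
    |cfun N q δ x - x| ≤ 1 / N := by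
  have hN : (0 : ℝ) < N := by exact_mod_cast g.hN
  have := sum_close (fun k => rampf (q k) δ x) N (N * x) (by positivity) (by nlinarith)
    (fun k => ⟨rampf_nonneg _ _ _, rampf_le _ _ _⟩)
    (fun k hk h => rampf_one g.hδ ((g.hi k hk).trans (by rw [div_le_iff₀ hN]; linarith)))
    (fun k hk h => rampf_zero g.hδ (le_trans (by rw [le_div_iff₀ hN]; linarith) (g.lo k hk)))
  have e : cfun N q δ x - x = (∑ k ∈ Finset.range N, rampf (q k) δ x - N * x) / N := by
    unfold cfun; field_simp
  rw [e, abs_div, abs_of_pos hN]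
  gcongr

lemma cfun_at_zero {N : ℕ} {q : ℕ → ℝ} {δ : ℝ} (g : GoodQ N q δ) : cfun N q δ 0 = 0 := by
  unfold cfun
  rw [sum_step _ 0 N (by omega) (by simp) (fun k _ hk => rampf_zero g.hδ
    (le_trans (by positivity) (g.lo k hk)))]
  simp

lemma cfun_at_one {N : ℕ} {q : ℕ → ℝ} {δ : ℝ} (g : GoodQ N q δ) : cfun N q δ 1 = 1 := by
  have hN : (0 : ℝ) < N := by exact_mod_cast g.hN
  unfold cfun
  rw [sum_step _ N N le_rfl (fun k hk => rampf_one g.hδ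
    ((g.hi k hk).trans ?_)) (by intros; omega)]
  · field_simp
  · rw [div_le_one hN]; exact_mod_cast hk

def coll {n : ℕ} (N : ℕ) (q : Fin n → ℕ → ℝ) (δ : ℝ) : C(Cube n, Cube n) :=
  ⟨fun x i => ⟨cfun N (q i) δ (x i), cfun_nonneg _ _ _ _, cfun_le _ _ _ _⟩, by
    refine continuous_pi fun i => Continuous.subtype_mk ?_ _
    exact (cfun_cont _ _ _).comp (continuous_subtype_val.comp (continuous_apply i))⟩

lemma coll_apply {n : ℕ} (N : ℕ) (q : Fin n → ℕ → ℝ) (δ : ℝ) (x : Cube n) (i : Fin n) :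
    ((coll N q δ x i : I) : ℝ) = cfun N (q i) δ (x i) := rfl

lemma coll_face {n : ℕ} {N : ℕ} {q : Fin n → ℕ → ℝ} {δ : ℝ} (g : ∀ i, GoodQ N (q i) δ) :
    FacePres (coll N q δ) := by
  intro x i
  constructor
  · intro h
    apply Subtype.ext
    rw [coll_apply, h]
    exact cfun_at_zero (g i)
  · intro h
    apply Subtype.ext
    rw [coll_apply, h]
    exact cfun_at_one (g i)

lemma coll_close {n : ℕ} {N : ℕ} {q : Fin n → ℕ → ℝ} {δ : ℝ} (g : ∀ i, GoodQ N (q i) δ)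
    (x : Cube n) (i : Fin n) : |((coll N q δ x i : I) : ℝ) - x i| ≤ 1 / N := by
  rw [coll_apply]
  exact cfun_close (g i) (x i).2.1 (x i).2.2

/-- standard collapse -/
def stdq (N : ℕ) (k : ℕ) : ℝ := ((k : ℝ) + 1 / 2) / N
def stdd (N : ℕ) : ℝ := 1 / (8 * N)

lemma sgood {N : ℕ} (hN : 0 < N) : GoodQ N (stdq N) (stdd N) := by
  have hN' : (0 : ℝ) < N := by exact_mod_cast hN
  refine ⟨hN, by unfold stdd; positivity, fun k _ => ?_, fun k _ => ?_⟩
  · have : stdq N k - stdd N = ((k : ℝ) + 3 / 8) / N := by unfold stdq stdd; field_simp; ring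
    rw [this]; gcongr; linarith
  · have : stdq N k + stdd N = ((k : ℝ) + 5 / 8) / N := by unfold stdq stdd; field_simp; ring
    rw [this]; gcongr; linarith

lemma sramp_zero {N : ℕ} (hN : 0 < N) {k : ℕ} {x : ℝ} (h : N * x ≤ k + 3 / 8) :
    rampf (stdq N k) (stdd N) x = 0 := by
  have hN' : (0 : ℝ) < N := by exact_mod_cast hN
  apply rampf_zero (sgood hN).hδ
  have : stdq N k - stdd N = ((k : ℝ) + 3 / 8) / N := by unfold stdq stdd; field_simp; ring
  rw [this, le_div_iff₀ hN']; linarith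

lemma sramp_one {N : ℕ} (hN : 0 < N) {k : ℕ} {x : ℝ} (h : k + 5 / 8 ≤ N * x) :
    rampf (stdq N k) (stdd N) x = 1 := by
  have hN' : (0 : ℝ) < N := by exact_mod_cast hN
  apply rampf_one (sgood hN).hδ
  have : stdq N k + stdd N = ((k : ℝ) + 5 / 8) / N := by unfold stdq stdd; field_simp; ring
  rw [this, div_le_iff₀ hN']; linarith

lemma scfun_vertex {N : ℕ} (hN : 0 < N) {v : ℕ} (hv : v ≤ N) {x : ℝ}
    (h : |N * x - v| ≤ 3 / 8) : cfun N (stdq N) (stdd N) x = v / N := by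
  rw [abs_le] at h
  unfold cfun
  rw [sum_step _ v N hv]
  · intro k hk
    have : (k : ℝ) + 1 ≤ v := by exact_mod_cast hk
    exact sramp_one hN (by linarith)
  · intro k hk _
    have : (v : ℝ) ≤ k := by exact_mod_cast hk
    exact sramp_zero hN (by linarith)

lemma scfun_edge {N : ℕ} (hN : 0 < N) {v : ℕ} (hv : v < N) {x : ℝ}
    (h0 : v ≤ N * x) (h1 : N * x ≤ v + 1) :
    cfun N (stdq N) (stdd N) x = (v + rampf (stdq N v) (stdd N) x) / N := by
  unfold cfun
  rw [sum_step' _ v N hv]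
  · intro k hk
    have : (k : ℝ) + 1 ≤ v := by exact_mod_cast hk
    exact sramp_one hN (by linarith)
  · intro k hk _
    have : (v : ℝ) + 1 ≤ k := by exact_mod_cast hk
    exact sramp_zero hN (by linarith)

end collapse

section steps
variable {n : ℕ} {X : Type*} [TopologicalSpace X] {x0 : X}

def Loc (r : ℝ) (T : GenLoop (Fin n) X x0 → GenLoop (Fin n) X x0) : Prop :=
  ∀ a b x, (∀ y : Cube n, (∀ i, |(y i : ℝ) - x i| ≤ r) → a.1 y = b.1 y) → (T a).1 x = (T b).1 x

lemma Loc.comp {r s : ℝ} {T S : GenLoop (Fin n) X x0 → GenLoop (Fin n) X x0}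
    (hT : Loc r T) (hS : Loc s S) : Loc (r + s) (fun a => T (S a)) := by
  intro a b x h
  refine hT _ _ x fun y hy => hS _ _ y fun z hz => h z fun i => ?_
  have := abs_add_le ((z i : ℝ) - y i) ((y i : ℝ) - x i)
  rw [sub_add_sub_cancel] at this
  linarith [hy i, hz i]

def gpt (N : ℕ) (v : Fin n → Fin (N + 1)) : Cube n := fun i => pI ((v i : ℕ) / N)

lemma gpt_apply {N : ℕ} (v : Fin n → Fin (N + 1)) (i : Fin n) :
    ((gpt N v i : I) : ℝ) = ((v i : ℕ) : ℝ) / N := by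
  apply pI_of_mem (by positivity)
  refine div_le_one_of_le₀ ?_ (Nat.cast_nonneg _)
  exact_mod_cast Nat.lt_succ_iff.mp (v i).2

def tent (u : ℝ) : I := pI (2 - 8 * |u|)

lemma tent_cont : Continuous tent :=
  pI_cont.comp (continuous_const.sub (continuous_const.mul continuous_abs))

lemma tent_ne {u : ℝ} (h : tent u ≠ 0) : |u| < 1 / 4 := by
  have := pI_ne_zero h
  linarith

lemma tent_one {u : ℝ} (h : |u| ≤ 1 / 8) : tent u = 1 := pI_one (by linarith)

def vphi (N : ℕ) (v : Fin n → Fin (N + 1)) : C(Cube n, I) :=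
  ⟨fun x => ∏ i, tent (N * (x i : ℝ) - (v i : ℕ)), by
    refine continuous_finsetProd _ fun i _ => tent_cont.comp ?_
    exact (continuous_const.mul (continuous_subtype_val.comp (continuous_apply i))).sub
      continuous_const⟩

lemma vphi_apply {N : ℕ} {v : Fin n → Fin (N + 1)} {x : Cube n} :
    vphi N v x = ∏ i, tent (N * (x i : ℝ) - (v i : ℕ)) := rfl

lemma vphi_ne {N : ℕ} {v : Fin n → Fin (N + 1)} {x : Cube n} (h : vphi N v x ≠ 0) (i : Fin n) :
    |N * (x i : ℝ) - (v i : ℕ)| < 1 / 4 := by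
  rw [vphi_apply] at h
  exact tent_ne (Finset.prod_ne_zero_iff.mp h i (Finset.mem_univ i))

lemma nat_close {a b : ℕ} {y : ℝ} (h1 : |y - a| < 1 / 4) (h2 : |y - b| < 1 / 4) : a = b := by
  rw [abs_lt] at h1 h2
  have h3 : (a : ℝ) < b + 1 := by linarith
  have h4 : (b : ℝ) < a + 1 := by linarith
  norm_cast at h3 h4
  omega

lemma isClosed_near (N : ℕ) (v : ℕ) (i : Fin n) (r : ℝ) :
    IsClosed {x : Cube n | |N * (x i : ℝ) - v| ≤ r} := by
  refine isClosed_le ?_ continuous_const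
  exact ((continuous_const.mul (continuous_subtype_val.comp (continuous_apply i))).sub
      continuous_const).abs

lemma vphi_closure {N : ℕ} {v : Fin n → Fin (N + 1)} {x : Cube n}
    (h : x ∈ closure {x | vphi N v x ≠ 0}) (i : Fin n) :
    |N * (x i : ℝ) - (v i : ℕ)| ≤ 1 / 4 := by
  refine (closure_minimal (t := {x : Cube n | |N * (x i : ℝ) - (v i : ℕ)| ≤ 1 / 4}) ?_
    (isClosed_near N _ i _)) h
  intro y hy
  exact (vphi_ne hy i).le

lemma bdry_zero {N : ℕ} {v : ℕ} {x : I} (h : |N * (x : ℝ) - v| < 1 / 4) (hx : x = 0) :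
    v = 0 := by
  subst hx
  refine nat_close h (by simp)

lemma bdry_one {N : ℕ} {v : ℕ} {x : I} (h : |N * (x : ℝ) - v| < 1 / 4) (hx : x = 1) :
    v = N := by
  subst hx
  refine nat_close h (by simp)

/-- Standard collapse. -/
def scoll (N : ℕ) : C(Cube n, Cube n) := coll N (fun _ => stdq N) (stdd N)

lemma scoll_face {N : ℕ} (hN : 0 < N) : FacePres (scoll (n := n) N) :=
  coll_face fun _ => sgood hN

lemma scoll_vertex {N : ℕ} (hN : 0 < N) {v : Fin n → Fin (N + 1)} {x : Cube n}
    (h : ∀ i, |N * (x i : ℝ) - (v i : ℕ)| ≤ 3 / 8) : scoll N x = gpt N v := by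
  funext i
  apply Subtype.ext
  rw [gpt_apply]
  exact scfun_vertex hN (Nat.lt_succ_iff.mp (v i).2) (h i)

lemma near_of {N : ℕ} (hN : 0 < N) {x : ℝ} {v : ℝ} {r : ℝ} (h : |N * x - v| ≤ r) :
    |v / N - x| ≤ r / N := by
  have hN' : (0 : ℝ) < N := by exact_mod_cast hN
  have : v / N - x = -(N * x - v) / N := by field_simp; ring
  rw [this, abs_div, abs_neg, abs_of_pos hN']
  gcongr

lemma stepA [PathConnectedSpace X] {N : ℕ} (hN : 0 < N) :
    ∃ T : GenLoop (Fin n) X x0 → GenLoop (Fin n) X x0,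
      (∀ a, GenLoop.Homotopic (T a) a) ∧ Loc (1 / N) T ∧
      ∀ a v, (T a).1 (gpt N v) = x0 := by
  have hN' : (0 : ℝ) < N := by exact_mod_cast hN
  have hγ : ∃ γ : ∀ x : X, Path x x0, γ x0 = Path.refl x0 := by
    refine ⟨fun x => if h : x = x0 then (Path.refl x0).cast h rfl
      else PathConnectedSpace.somePath x x0, ?_⟩
    simp
  obtain ⟨γ, hγ⟩ := hγ
  have key : ∀ a : GenLoop (Fin n) X x0, ∃ b : GenLoop (Fin n) X x0, GenLoop.Homotopic b a ∧
      (∀ v x, vphi N v x ≠ 0 → b.1 x = γ (a.1 (gpt N v)) (vphi N v x)) ∧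
      (∀ x, (∀ v, vphi N v x = 0) → b.1 x = a.1 (scoll N x)) := by
    intro a
    refine Exists.elim (modLoop (compLoop a (scoll N) (scoll_face hN))
      (fun v : Fin n → Fin (N + 1) => vphi N v)
      (fun v => ⟨fun q => γ (a.1 (gpt N v)) q.2, by fun_prop⟩) ?_ ?_ ?_) ?_
    rotate_left 3
    · rintro b ⟨h1, h2, h3⟩
      exact ⟨b, h1.trans (compLoop_homotopic _ _ _), h2, h3⟩
    · intro v w x hv hw
      funext i
      exact Fin.ext (nat_close (vphi_ne hv i) (vphi_ne hw i))
    · intro v x hx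
      change γ (a.1 (gpt N v)) 0 = a.1 (scoll N x)
      rw [Path.source, scoll_vertex hN (v := v)]
      intro i
      linarith [vphi_closure hx i]
    · intro v x t hx hv
      change γ (a.1 (gpt N v)) t = x0
      have : gpt N v ∈ Cube.boundary (Fin n) := by
        obtain ⟨i, hi⟩ := hx
        refine ⟨i, hi.imp (fun h => ?_) (fun h => ?_)⟩
        · apply Subtype.ext
          rw [gpt_apply, bdry_zero (vphi_ne hv i) h]; simp
        · apply Subtype.ext
          rw [gpt_apply, bdry_one (vphi_ne hv i) h]
          simp [hN'.ne']
      rw [show a.1 (gpt N v) = x0 from a.2 _ this, hγ]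
      rfl
  choose T T1 T2 T3 using key
  refine ⟨T, T1, ?_, ?_⟩
  · intro a b x h
    by_cases hx : ∃ v, vphi N v x ≠ 0
    · obtain ⟨v, hv⟩ := hx
      rw [T2 a v x hv, T2 b v x hv, h (gpt N v)]
      intro i
      rw [gpt_apply]
      exact near_of hN (by linarith [vphi_ne hv i])
    · push Not at hx
      rw [T3 a x hx, T3 b x hx]
      exact h _ (coll_close (fun _ => sgood hN) x)
  · intro a v
    have : vphi N v (gpt N v) = 1 := by
      rw [vphi_apply]
      refine Finset.prod_eq_one fun i _ => tent_one ?_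
      rw [gpt_apply, mul_div_cancel₀ _ hN'.ne', sub_self, abs_zero]
      norm_num
    rw [T2 a v _ (by rw [this]; exact one_ne_zero), this, Path.target]

/-! edges -/

def ept (N : ℕ) (i : Fin n) (v : Fin n → Fin (N + 1)) : C(I, Cube n) :=
  ⟨fun s j => if j = i then pI (((v j : ℕ) + (s : ℝ)) / N) else pI ((v j : ℕ) / N), by
    refine continuous_pi fun j => ?_
    split_ifs
    · exact pI_cont.comp ((continuous_const.add continuous_subtype_val).div_const _)
    · exact continuous_const⟩

lemma ept_ne {N : ℕ} {i : Fin n} {v : Fin n → Fin (N + 1)} {s : I} {j : Fin n} (h : j ≠ i) :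
    ((ept N i v s j : I) : ℝ) = ((v j : ℕ) : ℝ) / N := by
  rw [← gpt_apply]
  simp [ept, gpt, h]

lemma ept_eq {N : ℕ} (hN : 0 < N) {i : Fin n} {v : Fin n → Fin (N + 1)} {s : I}
    (h : (v i : ℕ) < N) :
    ((ept N i v s i : I) : ℝ) = (((v i : ℕ) : ℝ) + s) / N := by
  have hN' : (0 : ℝ) < N := by exact_mod_cast hN
  have e : ept N i v s i = pI (((v i : ℕ) + (s : ℝ)) / N) := by simp [ept]
  rw [e]
  apply pI_of_mem
  · have := s.2.1; positivity
  · rw [div_le_one hN']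
    have : ((v i : ℕ) : ℝ) + 1 ≤ N := by exact_mod_cast h
    linarith [s.2.2]

lemma ept_zero {N : ℕ} {i : Fin n} {v : Fin n → Fin (N + 1)} : ept N i v 0 = gpt N v := by
  funext j
  by_cases h : j = i
  · subst h; simp [ept, gpt]
  · simp [ept, gpt, h]

lemma ept_one {N : ℕ} (hN : 0 < N) {i : Fin n} {v : Fin n → Fin (N + 1)} :
    ∃ w, ept N i v 1 = gpt N w := by
  have hN' : (0 : ℝ) < N := by exact_mod_cast hN
  by_cases hv : (v i : ℕ) < N
  · refine ⟨Function.update v i ⟨v i + 1, by omega⟩, ?_⟩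
    funext j
    by_cases h : j = i
    · subst h; simp [ept, gpt]
    · simp [ept, gpt, h]
  · refine ⟨v, ?_⟩
    have e : (v i : ℕ) = N := by have := (v i).2; omega
    funext j
    by_cases h : j = i
    · subst h
      simp only [ept, gpt, ContinuousMap.coe_mk, if_true, e, div_self hN'.ne']
      rw [pI_one le_rfl, pI_one]
      rw [le_div_iff₀ hN']; simp
    · simp [ept, gpt, h]

def bump (u : ℝ) : I := pI (8 * min u (1 - u) - 2)

lemma bump_cont : Continuous bump :=
  pI_cont.comp ((continuous_const.mul
    (continuous_id.min (continuous_const.sub continuous_id))).sub continuous_const)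

lemma bump_ne {u : ℝ} (h : bump u ≠ 0) : |u - 1 / 2| < 1 / 4 := by
  have := pI_ne_zero h
  have h1 := min_le_left u (1 - u)
  have h2 := min_le_right u (1 - u)
  rw [abs_lt]; constructor <;> linarith

lemma bump_one {u : ℝ} (h0 : 3 / 8 ≤ u) (h1 : u ≤ 5 / 8) : bump u = 1 := by
  apply pI_one
  have : 3 / 8 ≤ min u (1 - u) := le_min h0 (by linarith)
  linarith

lemma bump_pos {u : ℝ} (h0 : 1 / 4 < u) (h1 : u < 3 / 4) : bump u ≠ 0 := by
  intro h
  have h2 : 1 / 4 < min u (1 - u) := lt_min h0 (by linarith)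
  have h3 := congrArg Subtype.val h
  change max 0 (min 1 (8 * min u (1 - u) - 2)) = 0 at h3
  have : 0 < min 1 (8 * min u (1 - u) - 2) := lt_min one_pos (by linarith)
  have := le_max_right 0 (min 1 (8 * min u (1 - u) - 2))
  linarith

def ephi (N : ℕ) (k : Fin n × (Fin n → Fin (N + 1))) : C(Cube n, I) :=
  ⟨fun x => ∏ j, if j = k.1 then bump (N * (x j : ℝ) - (k.2 j : ℕ))
      else tent (N * (x j : ℝ) - (k.2 j : ℕ)), by
    refine continuous_finsetProd _ fun j _ => ?_
    have : Continuous fun x : Cube n => N * (x j : ℝ) - (k.2 j : ℕ) :=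
      (continuous_const.mul (continuous_subtype_val.comp (continuous_apply j))).sub
        continuous_const
    split_ifs
    · exact bump_cont.comp this
    · exact tent_cont.comp this⟩

lemma ephi_apply {N : ℕ} {k : Fin n × (Fin n → Fin (N + 1))} {x : Cube n} :
    ephi N k x = ∏ j, if j = k.1 then bump (N * (x j : ℝ) - (k.2 j : ℕ))
      else tent (N * (x j : ℝ) - (k.2 j : ℕ)) := rfl

lemma ephi_ne {N : ℕ} {k : Fin n × (Fin n → Fin (N + 1))} {x : Cube n} (h : ephi N k x ≠ 0) :
    |N * (x k.1 : ℝ) - ((k.2 k.1 : ℕ) + 1 / 2)| < 1 / 4 ∧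
    ∀ j, j ≠ k.1 → |N * (x j : ℝ) - (k.2 j : ℕ)| < 1 / 4 := by
  rw [ephi_apply] at h
  have := Finset.prod_ne_zero_iff.mp h
  constructor
  · have h1 := this k.1 (Finset.mem_univ _)
    rw [if_pos rfl] at h1
    have := bump_ne h1
    rwa [sub_sub] at this
  · intro j hj
    have h1 := this j (Finset.mem_univ _)
    rw [if_neg hj] at h1
    exact tent_ne h1

lemma ephi_closure {N : ℕ} {k : Fin n × (Fin n → Fin (N + 1))} {x : Cube n}
    (h : x ∈ closure {x | ephi N k x ≠ 0}) :
    |N * (x k.1 : ℝ) - ((k.2 k.1 : ℕ) + 1 / 2)| ≤ 1 / 4 ∧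
    ∀ j, j ≠ k.1 → |N * (x j : ℝ) - (k.2 j : ℕ)| ≤ 1 / 4 := by
  constructor
  · refine (closure_minimal (t := {x : Cube n |
      |N * (x k.1 : ℝ) - ((k.2 k.1 : ℕ) + 1 / 2)| ≤ 1 / 4}) ?_ ?_) h
    · intro y hy
      exact (ephi_ne hy).1.le
    · refine isClosed_le ?_ continuous_const
      exact ((continuous_const.mul (continuous_subtype_val.comp (continuous_apply k.1))).sub
        continuous_const).abs
  · intro j hj
    refine (closure_minimal (t := {x : Cube n | |N * (x j : ℝ) - (k.2 j : ℕ)| ≤ 1 / 4}) ?_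
      (isClosed_near N _ j _)) h
    intro y hy
    exact ((ephi_ne hy).2 j hj).le

lemma edge_lt {N : ℕ} {v : ℕ} {x : I} (h : |N * (x : ℝ) - (v + 1 / 2)| ≤ 1 / 4) : v < N := by
  rw [abs_le] at h
  have : (N : ℝ) * x ≤ N := by nlinarith [x.2.2, (Nat.cast_nonneg N : (0 : ℝ) ≤ N)]
  have : (v : ℝ) < N := by linarith
  exact_mod_cast this

lemma half_ne {a b : ℕ} {y : ℝ} (h1 : |y - (a + 1 / 2)| < 1 / 4) (h2 : |y - b| < 1 / 4) :
    False := by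
  rw [abs_lt] at h1 h2
  have h3 : (a : ℝ) < b := by linarith
  have h4 : (b : ℝ) < a + 1 := by linarith
  norm_cast at h3 h4
  omega

lemma half_eq {a b : ℕ} {y : ℝ} (h1 : |y - (a + 1 / 2)| < 1 / 4)
    (h2 : |y - (b + 1 / 2)| < 1 / 4) : a = b := by
  rw [abs_lt] at h1 h2
  have h3 : (a : ℝ) < b + 1 := by linarith
  have h4 : (b : ℝ) < a + 1 := by linarith
  norm_cast at h3 h4
  omega

def sramp (N : ℕ) (v : ℕ) (x : I) : I := pI (((x : ℝ) - stdq N v) / (2 * stdd N) + 1 / 2)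

lemma sramp_cont (N v : ℕ) : Continuous (sramp N v) :=
  pI_cont.comp (((continuous_subtype_val.sub continuous_const).div_const _).add continuous_const)

lemma sramp_coe (N v : ℕ) (x : I) : (sramp N v x : ℝ) = rampf (stdq N v) (stdd N) x := rfl

lemma scoll_edge {N : ℕ} (hN : 0 < N) {k : Fin n × (Fin n → Fin (N + 1))} {x : Cube n}
    (h : |N * (x k.1 : ℝ) - ((k.2 k.1 : ℕ) + 1 / 2)| ≤ 1 / 4 ∧
      ∀ j, j ≠ k.1 → |N * (x j : ℝ) - (k.2 j : ℕ)| ≤ 1 / 4) :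
    scoll N x = ept N k.1 k.2 (sramp N (k.2 k.1) (x k.1)) := by
  funext j
  apply Subtype.ext
  by_cases hj : j = k.1
  · subst hj
    have hl := edge_lt h.1
    rw [ept_eq hN hl, sramp_coe]
    have := abs_le.mp h.1
    exact scfun_edge hN hl (by linarith) (by linarith)
  · rw [ept_ne hj]
    exact scfun_vertex hN (Nat.lt_succ_iff.mp (k.2 j).2) (by linarith [h.2 j hj])

lemma exists_null [SimplyConnectedSpace X] :
    ∃ Hn : C(I, X) → C(I × I, X), (∀ e : C(I, X), e 0 = x0 → e 1 = x0 →
        (∀ s, Hn e (s, 0) = e s) ∧ (∀ s, Hn e (s, 1) = x0) ∧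
        (∀ t, Hn e (0, t) = x0) ∧ (∀ t, Hn e (1, t) = x0)) ∧
      (∀ e : C(I, X), (∀ s, e s = x0) → ∀ q, Hn e q = x0) := by
  have : ∀ e : C(I, X), ∃ H : C(I × I, X), (e 0 = x0 → e 1 = x0 →
        (∀ s, H (s, 0) = e s) ∧ (∀ s, H (s, 1) = x0) ∧
        (∀ t, H (0, t) = x0) ∧ (∀ t, H (1, t) = x0)) ∧
      ((∀ s, e s = x0) → ∀ q, H q = x0) := by
    intro e
    by_cases hc : ∀ s, e s = x0
    · refine ⟨ContinuousMap.const _ x0, fun _ _ => ⟨fun s => (hc s).symm, fun _ => rfl,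
        fun _ => rfl, fun _ => rfl⟩, fun _ _ => rfl⟩
    · by_cases he : e 0 = x0 ∧ e 1 = x0
      · let p : Path x0 x0 := ⟨e, he.1, he.2⟩
        obtain ⟨F⟩ := SimplyConnectedSpace.paths_homotopic p (Path.refl x0)
        refine ⟨⟨fun q => F (q.2, q.1), by fun_prop⟩, fun _ _ => ⟨?_, ?_, ?_, ?_⟩,
          fun h => absurd h hc⟩
        · intro s; exact F.apply_zero s
        · intro s; exact F.apply_one s
        · intro t; exact F.source t
        · intro t; exact F.target t
      · refine ⟨ContinuousMap.const _ x0, fun h1 h2 => absurd ⟨h1, h2⟩ he, fun h => absurd h hc⟩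
  choose Hn h1 h2 using this
  exact ⟨Hn, h1, h2⟩

lemma stepB [SimplyConnectedSpace X] {N : ℕ} (hN : 0 < N) :
    ∃ T : {a : GenLoop (Fin n) X x0 // ∀ v, a.1 (gpt N v) = x0} → GenLoop (Fin n) X x0,
      (∀ a, GenLoop.Homotopic (T a) a.1) ∧
      (∀ a b x, (∀ y : Cube n, (∀ i, |(y i : ℝ) - x i| ≤ 1 / N) → a.1.1 y = b.1.1 y) →
        (T a).1 x = (T b).1 x) ∧
      ∀ a x i, (∀ j, j ≠ i → ∃ k : ℕ, k ≤ N ∧ (x j : ℝ) = k / N) → (T a).1 x = x0 := by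
  have hN' : (0 : ℝ) < N := by exact_mod_cast hN
  obtain ⟨Hn, Hn1, Hn2⟩ := exists_null (X := X) (x0 := x0)
  have ends : ∀ (a : {a : GenLoop (Fin n) X x0 // ∀ v, a.1 (gpt N v) = x0}) i v,
      (a.1.1.comp (ept N i v)) 0 = x0 ∧ (a.1.1.comp (ept N i v)) 1 = x0 := by
    intro a i v
    constructor
    · rw [ContinuousMap.comp_apply, ept_zero]; exact a.2 v
    · obtain ⟨w, hw⟩ := ept_one hN (i := i) (v := v)
      rw [ContinuousMap.comp_apply, hw]; exact a.2 w
  have key : ∀ a : {a : GenLoop (Fin n) X x0 // ∀ v, a.1 (gpt N v) = x0},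
      ∃ b : GenLoop (Fin n) X x0, GenLoop.Homotopic b a.1 ∧
      (∀ k x, ephi N k x ≠ 0 → b.1 x = Hn (a.1.1.comp (ept N k.1 k.2))
        (sramp N (k.2 k.1) (x k.1), ephi N k x)) ∧
      (∀ x, (∀ k, ephi N k x = 0) → b.1 x = a.1.1 (scoll N x)) := by
    intro a
    refine Exists.elim (modLoop (compLoop a.1 (scoll N) (scoll_face hN))
      (fun k : Fin n × (Fin n → Fin (N + 1)) => ephi N k)
      (fun k => ⟨fun q => Hn (a.1.1.comp (ept N k.1 k.2)) (sramp N (k.2 k.1) (q.1 k.1), q.2), by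
        have := sramp_cont N (k.2 k.1)
        fun_prop⟩) ?_ ?_ ?_) ?_
    rotate_left 3
    · rintro b ⟨h1, h2, h3⟩
      exact ⟨b, h1.trans (compLoop_homotopic _ _ _), h2, h3⟩
    · rintro ⟨i, v⟩ ⟨j, w⟩ x hv hw
      have hv' := ephi_ne hv
      have hw' := ephi_ne hw
      dsimp only at hv' hw'
      by_cases hij : i = j
      · subst hij
        congr 1
        funext l
        by_cases hl : l = i
        · subst hl
          exact Fin.ext (half_eq hv'.1 hw'.1)
        · exact Fin.ext (nat_close (hv'.2 l hl) (hw'.2 l hl))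
      · exact (half_ne hv'.1 (hw'.2 i hij)).elim
    · intro k x hx
      change Hn (a.1.1.comp (ept N k.1 k.2)) (sramp N (k.2 k.1) (x k.1), 0) = a.1.1 (scoll N x)
      rw [(Hn1 _ (ends a _ _).1 (ends a _ _).2).1, scoll_edge hN (ephi_closure hx)]
      rfl
    · intro k x t hx hk
      refine Hn2 _ (fun s => ?_) _
      refine a.1.2 _ ?_
      have hk' := ephi_ne hk
      obtain ⟨i, hi⟩ := hx
      have hik : i ≠ k.1 := by
        intro e
        subst e
        rcases hi with hi | hi
        · rw [hi] at hk'
          exact half_ne (b := 0) hk'.1 (by simp)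
        · rw [hi] at hk'
          exact half_ne (b := N) hk'.1 (by simp)
      refine ⟨i, hi.imp (fun h => ?_) (fun h => ?_)⟩
      · apply Subtype.ext
        rw [ept_ne hik, bdry_zero (hk'.2 i hik) h]; simp
      · apply Subtype.ext
        rw [ept_ne hik, bdry_one (hk'.2 i hik) h]
        simp [hN'.ne']
  choose T T1 T2 T3 using key
  refine ⟨T, T1, ?_, ?_⟩
  · intro a b x h
    by_cases hx : ∃ k, ephi N k x ≠ 0
    · obtain ⟨k, hk⟩ := hx
      have hk' := ephi_ne hk
      rw [T2 a k x hk, T2 b k x hk]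
      congr 2
      ext s
      refine h _ fun j => ?_
      by_cases hj : j = k.1
      · subst hj
        rw [ept_eq hN (edge_lt hk'.1.le)]
        apply near_of hN
        have := abs_lt.mp hk'.1
        rw [abs_le]; constructor <;> linarith [s.2.1, s.2.2]
      · rw [ept_ne hj]
        exact near_of hN (by linarith [hk'.2 j hj])
    · push Not at hx
      rw [T3 a x hx, T3 b x hx]
      exact h _ (coll_close (fun _ => sgood hN) x)
  · intro a x i h
    by_cases hx : ∃ k, ephi N k x ≠ 0
    · obtain ⟨k, hk⟩ := hx
      have hk' := ephi_ne hk
      have e : k.1 = i := by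
        by_contra hne
        obtain ⟨w, _, hw⟩ := h _ hne
        have := hk'.1
        rw [hw, mul_div_cancel₀ _ hN'.ne'] at this
        exact half_ne (b := w) this (by simp)
      rw [T2 a k x hk]
      obtain ⟨-, e1, e2, e3⟩ := Hn1 _ (ends a k.1 k.2).1 (ends a k.1 k.2).2
      rcases le_total (N * (x k.1 : ℝ) - (k.2 k.1 : ℕ)) (3 / 8) with c1 | c1
      · have : sramp N (k.2 k.1) (x k.1) = 0 := by
          apply Subtype.ext
          rw [sramp_coe]
          exact sramp_zero hN (by linarith)
        rw [this, e2]
      rcases le_total (5 / 8) (N * (x k.1 : ℝ) - (k.2 k.1 : ℕ)) with c2 | c2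
      · have : sramp N (k.2 k.1) (x k.1) = 1 := by
          apply Subtype.ext
          rw [sramp_coe]
          exact sramp_one hN (by linarith)
        rw [this, e3]
      have : ephi N k x = 1 := by
        rw [ephi_apply]
        refine Finset.prod_eq_one fun j _ => ?_
        by_cases hj : j = k.1
        · rw [if_pos hj]
          subst hj
          exact bump_one c1 c2
        · rw [if_neg hj]
          apply tent_one
          obtain ⟨w, _, hw⟩ := h j (by rw [← e]; exact hj)
          have := hk'.2 j hj
          rw [hw, mul_div_cancel₀ _ hN'.ne'] at this ⊢
          have : w = (k.2 j : ℕ) := nat_close (y := w) (by simp) this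
          rw [this]; simp
      rw [this, e1]
    · push Not at hx
      rw [T3 a x hx]
      have hv : ∀ j, ∃ v : Fin (N + 1), |N * (x j : ℝ) - (v : ℕ)| ≤ 3 / 8 ∧
          (j ≠ i → N * (x j : ℝ) = (v : ℕ)) ∨ (j = i ∧ 1 / 4 < N * (x j : ℝ) - (v : ℕ) ∧
            N * (x j : ℝ) - (v : ℕ) < 3 / 4) := by
        intro j
        by_cases hj : j = i
        · have y0 : 0 ≤ (N : ℝ) * x j := mul_nonneg hN'.le (x j).2.1
          have y1 : (N : ℝ) * x j ≤ N := by nlinarith [(x j).2.2]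
          have f0 := Nat.floor_le y0
          have f1 := Nat.lt_floor_add_one ((N : ℝ) * x j)
          have f2 : ⌊(N : ℝ) * x j⌋₊ ≤ N := by
            have := f0.trans y1
            exact_mod_cast this
          rcases le_or_gt ((N : ℝ) * x j - ⌊(N : ℝ) * x j⌋₊) (1 / 4) with c1 | c1
          · refine ⟨⟨⌊(N : ℝ) * x j⌋₊, by omega⟩, Or.inl ⟨?_, fun h => absurd hj h⟩⟩
            rw [abs_le]; constructor <;> dsimp only <;> linarith
          rcases lt_or_ge ((N : ℝ) * x j - ⌊(N : ℝ) * x j⌋₊) (3 / 4) with c2 | c2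
          · exact ⟨⟨⌊(N : ℝ) * x j⌋₊, by omega⟩, Or.inr ⟨hj, c1, c2⟩⟩
          · have f3 : ⌊(N : ℝ) * x j⌋₊ < N := by
              have : (⌊(N : ℝ) * x j⌋₊ : ℝ) < N := by linarith
              exact_mod_cast this
            refine ⟨⟨⌊(N : ℝ) * x j⌋₊ + 1, by omega⟩, Or.inl ⟨?_, fun h => absurd hj h⟩⟩
            dsimp only
            push_cast
            rw [abs_le]; constructor <;> linarith
        · obtain ⟨w, hw, e⟩ := h j hj
          refine ⟨⟨w, by omega⟩, Or.inl ⟨?_, fun _ => ?_⟩⟩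
          · rw [e, mul_div_cancel₀ _ hN'.ne']; norm_num
          · rw [e, mul_div_cancel₀ _ hN'.ne']
      choose v hv using hv
      have hall : ∀ j, |N * (x j : ℝ) - (v j : ℕ)| ≤ 3 / 8 := by
        intro j
        rcases hv j with hj | ⟨rfl, hj1, hj2⟩
        · exact hj.1
        · exfalso
          have := hx (j, v)
          rw [ephi_apply] at this
          refine absurd this (Finset.prod_ne_zero_iff.mpr fun l _ => ?_)
          by_cases hl : l = j
          · rw [if_pos hl]; subst hl
            exact bump_pos hj1 hj2
          · rw [if_neg hl]
            rcases hv l with hh | hh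
            · rw [tent_one]; · exact one_ne_zero
              dsimp only
              rw [hh.2 hl]; norm_num
            · exact absurd hh.1 hl
      rw [scoll_vertex hN hall]
      exact a.2 v

lemma stepAB [SimplyConnectedSpace X] {N : ℕ} (hN : 0 < N) :
    ∃ T : GenLoop (Fin n) X x0 → GenLoop (Fin n) X x0,
      (∀ a, GenLoop.Homotopic (T a) a) ∧ Loc (1 / N + 1 / N) T ∧
      ∀ a x i, (∀ j, j ≠ i → ∃ k : ℕ, k ≤ N ∧ (x j : ℝ) = k / N) → (T a).1 x = x0 := by
  obtain ⟨A, A1, A2, A3⟩ := stepA (n := n) (X := X) (x0 := x0) hN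
  obtain ⟨B, B1, B2, B3⟩ := stepB (n := n) (X := X) (x0 := x0) hN
  refine ⟨fun a => B ⟨A a, A3 a⟩, fun a => (B1 _).trans (A1 a), ?_, fun a => B3 _⟩
  intro a b x h
  refine B2 _ _ x fun y hy => A2 _ _ y fun z hz => h z fun i => ?_
  have := abs_add_le ((z i : ℝ) - y i) ((y i : ℝ) - x i)
  rw [sub_add_sub_cancel] at this
  linarith [hy i, hz i]

lemma stepC [SimplyConnectedSpace X] {N : ℕ} {q : Fin n → ℕ → ℝ} {δ : ℝ}
    (hN : 0 < N) (g : ∀ i, GoodQ N (q i) δ) :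
    ∃ T : GenLoop (Fin n) X x0 → GenLoop (Fin n) X x0,
      (∀ a, GenLoop.Homotopic (T a) a) ∧ Loc (3 / N) T ∧
      ∀ a x i, (∀ j, j ≠ i → ∀ k < N, (x j : ℝ) ≤ q j k - δ ∨ q j k + δ ≤ x j) →
        (T a).1 x = x0 := by
  obtain ⟨T, T1, T2, T3⟩ := stepAB (n := n) (X := X) (x0 := x0) hN
  refine ⟨fun a => compLoop (T a) (coll N q δ) (coll_face g),
    fun a => (compLoop_homotopic _ _ _).trans (T1 a), ?_, ?_⟩
  · intro a b x h
    refine T2 a b _ fun z hz => h z fun i => ?_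
    have := abs_add_le ((z i : ℝ) - coll N q δ x i) ((coll N q δ x i : ℝ) - x i)
    rw [sub_add_sub_cancel] at this
    have h2 := coll_close g x i
    have h3 := hz i
    have : (3 : ℝ) / N = 1 / N + 1 / N + 1 / N := by ring
    linarith
  · intro a x i h
    refine T3 a _ i fun j hj => ?_
    rw [coll_apply]
    exact cfun_nat (g j).hδ (h j hj)

end steps

section generic

lemma exists_indep (n N : ℕ) (hN : 0 < N) : ∃ p : Fin n → ℕ → ℝ,
    LinearIndependent ℚ (fun ik : Fin n × ℕ => p ik.1 ik.2) ∧
    ∀ (i : Fin n) (k : ℕ), (k : ℝ) / N < p i k ∧ p i k < ((k : ℝ) + 1) / N := by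
  have hN' : (0 : ℝ) < N := by exact_mod_cast hN
  have hc : Cardinal.mk (Fin n × ℕ) ≤ Module.rank ℚ ℝ := by
    rw [Real.rank_rat_real]
    exact (Cardinal.mk_le_aleph0).trans Cardinal.aleph0_le_continuum
  obtain ⟨s, hs, hi⟩ := le_rank_iff_exists_linearIndependent.mp hc
  obtain ⟨e⟩ := Cardinal.eq.mp hs
  have hr : LinearIndependent ℚ (fun ik : Fin n × ℕ => ((e.symm ik : s) : ℝ)) :=
    LinearIndependent.comp (v := fun x : s => (x : ℝ)) hi e.symm e.symm.injective
  have hsc : ∀ ik : Fin n × ℕ, ∃ c : ℚˣ, ((ik.2 : ℕ) : ℝ) / N < (c : ℚ) • ((e.symm ik : s) : ℝ) ∧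
      (c : ℚ) • ((e.symm ik : s) : ℝ) < (((ik.2 : ℕ) : ℝ) + 1) / N := by
    intro ik
    set r := ((e.symm ik : s) : ℝ) with hr'
    have hr0 : r ≠ 0 := hr.ne_zero ik
    have hlt : ((ik.2 : ℕ) : ℝ) / N < (((ik.2 : ℕ) : ℝ) + 1) / N := by gcongr; linarith
    have hnn : 0 ≤ ((ik.2 : ℕ) : ℝ) / N := by positivity
    have main : ∃ c : ℚ, ((ik.2 : ℕ) : ℝ) / N < c * r ∧ c * r < (((ik.2 : ℕ) : ℝ) + 1) / N := by
      rcases lt_or_gt_of_ne hr0 with h | h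
      · obtain ⟨c, c1, c2⟩ := exists_rat_btwn (div_lt_div_of_neg_of_lt h hlt)
        exact ⟨c, by rwa [lt_div_iff_of_neg h] at c2, by rwa [div_lt_iff_of_neg h] at c1⟩
      · obtain ⟨c, c1, c2⟩ := exists_rat_btwn ((div_lt_div_iff_of_pos_right h).mpr hlt)
        exact ⟨c, by rwa [div_lt_iff₀ h] at c1, by rwa [lt_div_iff₀ h] at c2⟩
    obtain ⟨c, c1, c2⟩ := main
    have hc0 : c ≠ 0 := by
      rintro rfl
      simp at c1
      linarith
    refine ⟨Units.mk0 c hc0, ?_, ?_⟩ <;> rw [Rat.smul_def] <;> simpa using ‹_›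
  choose c hc1 hc2 using hsc
  refine ⟨fun i k => (c (i, k) : ℚ) • ((e.symm (i, k) : s) : ℝ), ?_, fun i k => ⟨hc1 (i, k), hc2 (i, k)⟩⟩
  exact hr.units_smul c

lemma card_times {m : ℕ} (p : Fin (m + 1) → ℕ → ℝ)
    (hp : LinearIndependent ℚ (fun ik : Fin (m + 1) × ℕ => p ik.1 ik.2))
    (y : Fin (m + 1) → ℝ) (hy : y (Fin.last m) = 0) (T : Finset ℝ)
    (hT : ∀ t ∈ T, ∃ i j k l, i ≠ j ∧ t + y i = p i k ∧ t + y j = p j l) : T.card ≤ m := by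
  have hT' : ∀ t : T, ∃ i j k l, i ≠ j ∧ (t : ℝ) + y i = p i k ∧ (t : ℝ) + y j = p j l :=
    fun t => hT t t.2
  choose i j k l hij h1 h2 using hT'
  let f : T × Bool → Fin (m + 1) × ℕ := fun q =>
    bif q.2 then (i q.1, k q.1) else (j q.1, l q.1)
  have hf : ∀ q, (q.1 : ℝ) + y (f q).1 = p (f q).1 (f q).2 := by
    rintro ⟨t, _ | _⟩
    · exact h2 t
    · exact h1 t
  have hinj : Function.Injective f := by
    rintro q q' h
    have e1 := hf q
    have e2 := hf q'
    rw [h] at e1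
    have e3 : q.1 = q'.1 := Subtype.ext (by linarith)
    obtain ⟨t, b⟩ := q
    obtain ⟨t', b'⟩ := q'
    dsimp only at e3
    subst e3
    congr 1
    cases b <;> cases b' <;> simp [f] at h ⊢
    · exact hij t h.1.symm
    · exact hij t h.1
  have hli := hp.comp f hinj
  let w : Finset ℝ := T ∪ Finset.univ.image (fun a : Fin m => y a.castSucc)
  have hw : w.card ≤ T.card + m := by
    refine (Finset.card_union_le _ _).trans ?_
    have := Finset.card_image_le (s := (Finset.univ : Finset (Fin m)))
      (f := fun a : Fin m => y a.castSucc)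
    simp at this
    omega
  have hyw : ∀ a, y a ∈ Submodule.span ℚ (w : Set ℝ) := by
    intro a
    refine Fin.lastCases ?_ (fun b => ?_) a
    · rw [hy]; exact Submodule.zero_mem _
    · refine Submodule.subset_span ?_
      simp [w]
  have := linearIndependent_le_span_aux' _ hli (w : Set ℝ) (by
    rintro _ ⟨q, rfl⟩
    change p (f q).1 (f q).2 ∈ Submodule.span ℚ (w : Set ℝ)
    rw [← hf q]
    refine Submodule.add_mem _ (Submodule.subset_span ?_) (hyw _)
    simp [w])
  simp at this
  omega

def yv {m : ℕ} (v : Cube m) : Fin (m + 1) → ℝ :=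
  Fin.snoc (α := fun _ => ℝ) (fun i => 2 * (v i : ℝ) - 1) 0

lemma yv_last {m : ℕ} (v : Cube m) : yv v (Fin.last m) = 0 := by simp [yv]
lemma yv_cast {m : ℕ} (v : Cube m) (i : Fin m) : yv v i.castSucc = 2 * (v i : ℝ) - 1 := by
  simp [yv]

lemma yv_close {m : ℕ} {v w : Cube m} {ε : ℝ} (h : dist v w < ε) (i : Fin (m + 1)) :
    |yv v i - yv w i| ≤ 2 * ε := by
  have hε : 0 < ε := dist_nonneg.trans_lt h
  refine Fin.lastCases ?_ (fun j => ?_) i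
  · rw [yv_last, yv_last]; simp; exact hε.le
  · rw [yv_cast, yv_cast]
    have h1 := (dist_le_pi_dist v w j).trans h.le
    rw [Subtype.dist_eq, Real.dist_eq] at h1
    rw [abs_le] at h1 ⊢
    constructor <;> linarith

def shear (m : ℕ) : C(Cube (m + 1), Cube (m + 1)) :=
  ⟨fun x i => pI (yv (Fin.init x : Cube m) i + x (Fin.last m)), by
    refine continuous_pi fun i => pI_cont.comp ?_
    refine Fin.lastCases ?_ (fun j => ?_) i
    · simp only [yv_last]; fun_prop
    · simp only [yv_cast, Fin.init]; fun_prop⟩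

lemma shear_apply {m : ℕ} (x : Cube (m + 1)) (i : Fin (m + 1)) :
    shear m x i = pI (yv (Fin.init x : Cube m) i + x (Fin.last m)) := rfl

lemma shear_face (m : ℕ) : FacePres (shear m) := by
  intro x i
  rw [shear_apply]
  have h0 := (x (Fin.last m)).2.1
  have h1 := (x (Fin.last m)).2.2
  refine Fin.lastCases ?_ (fun j => ?_) i
  · rw [yv_last]
    constructor
    · intro h; rw [h]; exact pI_zero (by simp)
    · intro h; rw [h]; exact pI_one (by simp)
  · rw [yv_cast]
    constructor
    · intro h
      apply pI_zero
      have : ((Fin.init x : Cube m) j : ℝ) = 0 := by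
        change ((x j.castSucc : I) : ℝ) = 0
        rw [h]; rfl
      linarith
    · intro h
      apply pI_one
      have : ((Fin.init x : Cube m) j : ℝ) = 1 := by
        change ((x j.castSucc : I) : ℝ) = 1
        rw [h]; rfl
      linarith

lemma pI_eq_of_Ioo {u : ℝ} (h0 : 0 < ((pI u : I) : ℝ)) (h1 : ((pI u : I) : ℝ) < 1) :
    ((pI u : I) : ℝ) = u := by
  apply pI_of_mem
  · by_contra h
    rw [pI_zero (by linarith)] at h0
    simp at h0
  · by_contra h
    rw [pI_one (by linarith)] at h1
    simp at h1

lemma gap_exists {ι : Type*} [Finite ι] (f : ι → ℝ) :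
    ∀ᶠ ε in 𝓝[>] (0 : ℝ), ∀ a b, |f a - f b| ≤ 6 * ε → f a = f b := by
  rw [Filter.eventually_all]
  intro a
  rw [Filter.eventually_all]
  intro b
  by_cases h : f a = f b
  · exact Filter.Eventually.of_forall fun _ _ => h
  · have hp : 0 < |f a - f b| / 6 := by
      have := abs_pos.mpr (sub_ne_zero.mpr h); positivity
    filter_upwards [Ioo_mem_nhdsGT hp] with ε hε h2
    exfalso
    linarith [hε.2]

end generic

/-- Lemma 3.1: concentrating spheroids near a codimension-2 net. Given a
finite open cover `Γ` of `Iⁿ` (`n = m + 1 > 1`) and `X` simply connected, there are a finite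
open cover `Δ` of `Iⁿ⁻¹`, a function `λ : Δ → Γ(n−1)` and a function `Φ : Π_n(X) → Π_n(X)`
such that `Φ(a) ≃ a` rel `∂Iⁿ`, and `Φ(a)|_{F×I}` depends only on `a|_{λ(F)}`. -/
theorem concentration_near_net (X : Type*) [TopologicalSpace X] [SimplyConnectedSpace X]
    (x0 : X) (m : ℕ) (hm : 1 ≤ m)
    (Γ : Finset (Set (Cube (m + 1)))) (hΓo : ∀ E ∈ Γ, IsOpen E)
    (hΓc : ∀ u : Cube (m + 1), ∃ E ∈ Γ, u ∈ E) :
    ∃ (Δ : Finset (Set (Cube m))) (lam : Set (Cube m) → Set (Cube (m + 1)))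
      (Φ : GenLoop (Fin (m + 1)) X x0 → GenLoop (Fin (m + 1)) X x0),
      (∀ F ∈ Δ, IsOpen F) ∧ (∀ v : Cube m, ∃ F ∈ Δ, v ∈ F) ∧
      (∀ F ∈ Δ, lam F ∈ coverUnions Γ m) ∧
      (∀ a, GenLoop.Homotopic (Φ a) a) ∧
      (∀ F ∈ Δ, ∀ a a' : GenLoop (Fin (m + 1)) X x0,
        (∀ u, u ∈ lam F → a.1 u = a'.1 u) →
        ∀ u : Cube (m + 1), Fin.init u ∈ F → (Φ a).1 u = (Φ a').1 u) := by
  obtain ⟨ρ, hρ, hE⟩ : ∃ ρ > 0, ∀ z : Cube (m + 1), ∃ E ∈ Γ, Metric.ball z ρ ⊆ E := by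
    obtain ⟨ρ, hρ, h⟩ := lebesgue_number_lemma_of_metric_sUnion (s := Set.univ)
      (c := (Γ : Set (Set (Cube (m + 1))))) isCompact_univ (fun t ht => hΓo t ht) (by
        intro u _
        obtain ⟨E, h1, h2⟩ := hΓc u
        exact ⟨E, h1, h2⟩)
    exact ⟨ρ, hρ, fun z => h z trivial⟩
  choose Ef hEf hEb using hE
  obtain ⟨N, hN⟩ := exists_nat_gt (6 / ρ)
  have hN' : (0 : ℝ) < N := lt_trans (by positivity) hN
  have hN0 : 0 < N := by exact_mod_cast hN'
  have hNρ : 3 / (N : ℝ) < ρ / 2 := by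
    rw [div_lt_iff₀ hρ] at hN
    rw [div_lt_iff₀ hN']
    linarith
  obtain ⟨p, hp, hpk⟩ := exists_indep (m + 1) N hN0
  -- the local radii
  have hε : ∀ v : Cube m, ∃ ε : ℝ, 0 < ε ∧ ε < ρ / 20 ∧
      ∀ a b : Fin (m + 1) × Fin N, |(p a.1 a.2 - yv v a.1) - (p b.1 b.2 - yv v b.1)| ≤ 6 * ε →
        p a.1 a.2 - yv v a.1 = p b.1 b.2 - yv v b.1 := by
    intro v
    have h1 := gap_exists (fun a : Fin (m + 1) × Fin N => p a.1 a.2 - yv v a.1)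
    have h2 : ∀ᶠ ε in 𝓝[>] (0 : ℝ), ε ∈ Set.Ioo 0 (ρ / 20) := Ioo_mem_nhdsGT (by positivity)
    obtain ⟨ε, h3, h4⟩ := (h1.and h2).exists
    exact ⟨ε, h4.1, h4.2, h3⟩
  choose ε hε0 hερ hεg using hε
  obtain ⟨t, ht⟩ := CompactSpace.elim_nhds_subcover (fun v : Cube m => Metric.ball v (ε v))
    (fun v => Metric.ball_mem_nhds v (hε0 v))
  obtain ⟨δ, hδ0, hδε, hδp⟩ : ∃ δ : ℝ, 0 < δ ∧ (∀ v ∈ t, δ ≤ ε v) ∧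
      ∀ a : Fin (m + 1) × Fin N, ((a.2 : ℕ) : ℝ) / N ≤ p a.1 a.2 - δ ∧
        p a.1 a.2 + δ ≤ (((a.2 : ℕ) : ℝ) + 1) / N := by
    have h1 : ∀ᶠ δ in 𝓝[>] (0 : ℝ), ∀ v ∈ t, δ ≤ ε v := by
      rw [Filter.eventually_all_finset]
      intro v _
      filter_upwards [Ioo_mem_nhdsGT (hε0 v)] with δ hδ
      exact hδ.2.le
    have h2 : ∀ᶠ δ in 𝓝[>] (0 : ℝ), ∀ a : Fin (m + 1) × Fin N,
        ((a.2 : ℕ) : ℝ) / N ≤ p a.1 a.2 - δ ∧ p a.1 a.2 + δ ≤ (((a.2 : ℕ) : ℝ) + 1) / N := by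
      rw [Filter.eventually_all]
      intro a
      have g := hpk a.1 a.2
      filter_upwards [Ioo_mem_nhdsGT (sub_pos.mpr g.1), Ioo_mem_nhdsGT (sub_pos.mpr g.2)]
        with δ d1 d2
      exact ⟨by linarith [d1.2], by linarith [d2.2]⟩
    have h3 : ∀ᶠ δ in 𝓝[>] (0 : ℝ), 0 < δ := self_mem_nhdsWithin
    obtain ⟨δ, h4, h5, h6⟩ := (h3.and (h1.and h2)).exists
    exact ⟨δ, h4, h5, h6⟩
  have good : ∀ i, GoodQ N (p i) δ := fun i =>
    ⟨hN0, hδ0, fun k hk => (hδp (i, ⟨k, hk⟩)).1, fun k hk => (hδp (i, ⟨k, hk⟩)).2⟩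
  obtain ⟨T, T1, T2, T3⟩ := stepC (X := X) (x0 := x0) hN0 good
  let Φ : GenLoop (Fin (m + 1)) X x0 → GenLoop (Fin (m + 1)) X x0 :=
    fun a => compLoop (T a) (shear m) (shear_face m)
  have main : ∀ F ∈ t.image (fun v => Metric.ball v (ε v)), ∃ L ∈ coverUnions Γ m,
      ∀ a a' : GenLoop (Fin (m + 1)) X x0, (∀ u, u ∈ L → a.1 u = a'.1 u) →
        ∀ u : Cube (m + 1), Fin.init u ∈ F → (Φ a).1 u = (Φ a').1 u := by
    intro F hF
    obtain ⟨v, hv, rfl⟩ := Finset.mem_image.mp hF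
    let Ix := Fin (m + 1) × Fin N
    let W : Finset (Ix × Ix) := Finset.univ.filter fun q =>
      q.1.1 ≠ q.2.1 ∧ p q.1.1 q.1.2 - yv v q.1.1 = p q.2.1 q.2.2 - yv v q.2.1
    let Ts : Finset ℝ := W.image fun q => p q.1.1 q.1.2 - yv v q.1.1
    have hTs : Ts.card ≤ m := by
      refine card_times p hp (yv v) (yv_last v) Ts fun s hs => ?_
      obtain ⟨q, hq, rfl⟩ := Finset.mem_image.mp hs
      obtain ⟨-, hq1, hq2⟩ := Finset.mem_filter.mp hq
      exact ⟨q.1.1, q.2.1, q.1.2, q.2.2, hq1, by ring, by rw [hq2]; ring⟩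
    let z : ℝ → Cube (m + 1) := fun s i => pI (yv v i + s)
    refine ⟨⋃₀ ((Ts.image fun s => Ef (z s) : Finset _) : Set (Set (Cube (m + 1)))), ?_, ?_⟩
    · refine Finset.mem_image.mpr ⟨_, ?_, rfl⟩
      refine Finset.mem_sup.mpr ?_
      refine ⟨Ts.image fun s => Ef (z s), Finset.mem_filter.mpr ⟨?_, ?_⟩,
        Finset.mem_singleton.mpr rfl⟩
      · rw [Finset.mem_powerset]
        intro E hE
        obtain ⟨s, _, rfl⟩ := Finset.mem_image.mp hE
        exact hEf _
      · exact Finset.card_image_le.trans hTs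
    · intro a a' haa u hu
      change (T a).1 (shear m u) = (T a').1 (shear m u)
      by_cases hc : ∃ i, ∀ j, j ≠ i → ∀ k < N,
          (shear m u j : ℝ) ≤ p j k - δ ∨ p j k + δ ≤ shear m u j
      · obtain ⟨i, hi⟩ := hc
        rw [T3 a _ i hi, T3 a' _ i hi]
      · push Not at hc
        obtain ⟨i, -, k, hk, i1, i2⟩ := hc 0
        obtain ⟨j, hji, l, hl, j1, j2⟩ := hc i
        have val : ∀ (i : Fin (m + 1)) (k : ℕ), k < N → p i k - δ < (shear m u i : ℝ) →
            (shear m u i : ℝ) < p i k + δ →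
            |(u (Fin.last m) : ℝ) - (p i k - yv v i)| ≤ 3 * ε v := by
          intro i k hk i1 i2
          have g := hδp (i, ⟨k, hk⟩)
          have g0 : (0 : ℝ) ≤ (k : ℝ) / N := by positivity
          have g1 : ((k : ℝ) + 1) / N ≤ 1 := by
            rw [div_le_one hN']; exact_mod_cast hk
          dsimp only at g
          rw [shear_apply] at i1 i2
          have eqp := pI_eq_of_Ioo (u := yv (Fin.init u : Cube m) i + u (Fin.last m))
            (by linarith [g.1]) (by linarith [g.2])
          rw [eqp] at i1 i2
          have hy := abs_le.mp (yv_close (Metric.mem_ball.mp hu) i)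
          have hd := hδε v hv
          rw [abs_le]
          constructor <;> linarith [hy.1, hy.2]
        have vi := val i k hk i1 i2
        have vj := val j l hl j1 j2
        have heq : p i k - yv v i = p j l - yv v j := by
          refine hεg v (i, ⟨k, hk⟩) (j, ⟨l, hl⟩) ?_
          dsimp only
          rw [abs_le] at vi vj ⊢
          constructor <;> linarith [vi.1, vi.2, vj.1, vj.2]
        refine T2 a a' _ fun y hy => haa y ?_
        refine ⟨Ef (z (p i k - yv v i)), ?_, hEb _ ?_⟩
        · refine Finset.mem_coe.mpr (Finset.mem_image.mpr ⟨_, ?_, rfl⟩)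
          refine Finset.mem_image.mpr ⟨((i, ⟨k, hk⟩), (j, ⟨l, hl⟩)), ?_, rfl⟩
          exact Finset.mem_filter.mpr ⟨Finset.mem_univ _, Ne.symm hji, heq⟩
        · rw [Metric.mem_ball, dist_pi_lt_iff hρ]
          intro b
          rw [Subtype.dist_eq, Real.dist_eq]
          have e1 := hy b
          have e2 := pI_lip (yv (Fin.init u : Cube m) b + u (Fin.last m))
            (yv v b + (p i k - yv v i))
          rw [← shear_apply] at e2
          have e3 := abs_le.mp (yv_close (Metric.mem_ball.mp hu) b)
          have e4 := abs_le.mp vi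
          have e5 : |(yv (Fin.init u : Cube m) b + u (Fin.last m)) -
              (yv v b + (p i k - yv v i))| ≤ 5 * ε v := by
            rw [abs_le]; constructor <;> linarith [e3.1, e3.2, e4.1, e4.2]
          have e6 := abs_le.mp (e2.trans e5)
          have e7 := abs_le.mp e1
          have e8 := hερ v
          change |(y b : ℝ) - pI (yv v b + (p i k - yv v i))| < ρ
          rw [abs_lt]
          constructor <;> linarith [e6.1, e6.2, e7.1, e7.2]
  choose! lam hl1 hl2 using main
  refine ⟨t.image (fun v => Metric.ball v (ε v)), lam, Φ, ?_, ?_, hl1, ?_, hl2⟩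
  · intro F hF
    obtain ⟨v, _, rfl⟩ := Finset.mem_image.mp hF
    exact Metric.isOpen_ball
  · intro v
    have : v ∈ ⋃ x ∈ t, Metric.ball x (ε x) := by rw [ht]; trivial
    simp only [Set.mem_iUnion] at this
    obtain ⟨w, hw, hvw⟩ := this
    exact ⟨_, Finset.mem_image_of_mem _ hw, hvw⟩
  · intro a
    exact (compLoop_homotopic _ _ _).trans (T1 a)

end
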